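/- arXiv:1002.4504 — 5 statements merged into one kernel-verified Lean document; each statement's English description precedes it below -/
import Mathlib

section
/- For every integer n ≥ 1, the total number of humps, summed over all Dyck paths of length 2n, equals the binomial coefficient C(2n−1, n). -/
open Finset

/-- The value of a Dyck-path step: `true` is an up-step (+1), `false` a down-step (-1). -/
def stepVal (b : Bool) : ℤ := if b then 1 else -1

/-- Partial sum of the first `k` steps of a ±1 path of length `m`. -/
def partialSum {m : ℕ} (p : Fin m → Bool) (k : ℕ) : ℤ :=
  ∑ i ∈ Finset.univ.filter (fun i : Fin m => (i : ℕ) < k), stepVal (p i)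

/-- A Dyck path: total sum 0 and all partial sums nonnegative. -/
def IsDyckPath {m : ℕ} (p : Fin m → Bool) : Prop :=
  partialSum p m = 0 ∧ ∀ k ≤ m, 0 ≤ partialSum p k

open Classical in
/-- The finset of Dyck paths of length `m`. -/
noncomputable def dyckPaths (m : ℕ) : Finset (Fin m → Bool) :=
  Finset.univ.filter (fun p => IsDyckPath p)

/-- Number of humps (an up-step immediately followed by a down-step) of a path. -/
def humps {m : ℕ} (p : Fin m → Bool) : ℕ :=
  (Finset.univ.filter (fun i : Fin (m - 1) =>
    p ⟨(i : ℕ), by have := i.isLt; omega⟩ = true ∧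
    p ⟨(i : ℕ) + 1, by have := i.isLt; omega⟩ = false)).card

/-- `HC n`: the total number of humps over all Dyck paths of length `2n`. -/
noncomputable def HC (n : ℕ) : ℕ := ∑ p ∈ dyckPaths (2 * n), humps p

theorem partialSum_zero {m : ℕ} (p : Fin m → Bool) : partialSum p 0 = 0 := by
  simp [partialSum]

theorem partialSum_succ {m : ℕ} (p : Fin m → Bool) (k : ℕ) (hk : k < m) :
    partialSum p (k + 1) = partialSum p k + stepVal (p ⟨k, hk⟩) := by
  have h : Finset.univ.filter (fun i : Fin m => (i : ℕ) < k + 1) =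
      insert ⟨k, hk⟩ (Finset.univ.filter (fun i : Fin m => (i : ℕ) < k)) := by
    ext i
    simp [Fin.ext_iff]
    omega
  rw [partialSum, h, Finset.sum_insert (by simp), add_comm, partialSum]

theorem mem_dyckPaths {m : ℕ} {p : Fin m → Bool} : p ∈ dyckPaths m ↔ IsDyckPath p := by
  simp [dyckPaths]

/-- Insert an up-step followed by a down-step at position `i`. -/
def insertHump {m : ℕ} (i : ℕ) (q : Fin m → Bool) (j : Fin (m + 2)) : Bool :=
  if h : (j : ℕ) < i ∧ (j : ℕ) < m then q ⟨j, h.2⟩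
  else if (j : ℕ) = i then true
  else if h : i + 1 < (j : ℕ) then q ⟨j - 2, by have := j.isLt; omega⟩
  else false

theorem partialSum_insertHump_of_le {m i : ℕ} (q : Fin m → Bool) (hi : i ≤ m) (k : ℕ)
    (hk : k ≤ i) : partialSum (insertHump i q) k = partialSum q k := by
  induction k with
  | zero => simp [partialSum_zero]
  | succ k ih =>
    rw [partialSum_succ _ _ (by omega), partialSum_succ _ _ (by omega), ih (by omega), insertHump,
      dif_pos ⟨by simpa using hk, by simp; omega⟩]

theorem partialSum_insertHump_peak {m i : ℕ} (q : Fin m → Bool) (hi : i ≤ m) :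
    partialSum (insertHump i q) (i + 1) = partialSum q i + 1 := by
  rw [partialSum_succ _ _ (by omega), partialSum_insertHump_of_le q hi i le_rfl]
  simp [insertHump, stepVal]

theorem partialSum_insertHump_add_two {m i : ℕ} (q : Fin m → Bool) (hi : i ≤ m) (k : ℕ)
    (hk : i ≤ k) (hkm : k ≤ m) : partialSum (insertHump i q) (k + 2) = partialSum q k := by
  induction k, hk using Nat.le_induction with
  | base =>
    rw [partialSum_succ _ _ (by omega), partialSum_insertHump_peak q hi]
    simp [insertHump, stepVal]
  | succ k hk ih =>
    rw [show k + 1 + 2 = k + 2 + 1 by rfl, partialSum_succ _ (k + 2) (by omega),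
      partialSum_succ _ k (by omega), ih (by omega), insertHump, dif_neg (by simp; omega),
      if_neg (by simp; omega), dif_pos (by simp; omega)]
    simp

theorem isDyckPath_insertHump {m i : ℕ} (q : Fin m → Bool) (hi : i ≤ m) :
    IsDyckPath (insertHump i q) ↔ IsDyckPath q := by
  rw [IsDyckPath, IsDyckPath, partialSum_insertHump_add_two q hi m hi le_rfl]
  refine and_congr_right fun _ => ⟨fun h k hk => ?_, fun h k hk => ?_⟩
  · rcases le_total k i with hki | hik
    · simpa [partialSum_insertHump_of_le q hi k hki] using h k (by omega)
    · simpa [partialSum_insertHump_add_two q hi k hik hk] using h (k + 2) (by omega)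
  · rcases le_or_gt k i with hki | hik
    · simpa [partialSum_insertHump_of_le q hi k hki] using h k (by omega)
    · obtain rfl | hik' := Nat.eq_or_lt_of_le (Nat.succ_le_of_lt hik)
      · have := h i hi
        rw [Nat.succ_eq_add_one, partialSum_insertHump_peak q hi]
        omega
      · obtain ⟨l, rfl⟩ := Nat.exists_eq_add_of_le' (show 2 ≤ k by omega)
        rw [partialSum_insertHump_add_two q hi l (by omega) (by omega)]
        exact h l (by omega)

theorem insertHump_injective {m : ℕ} (i : ℕ) :
    Function.Injective (insertHump i : (Fin m → Bool) → Fin (m + 2) → Bool) := by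
  intro q r h
  ext1 j
  have hj := j.isLt
  by_cases hji : (j : ℕ) < i
  · simpa [insertHump, hji] using congrFun h ⟨j, by omega⟩
  · have := congrFun h ⟨j + 2, by omega⟩
    simpa [insertHump, show ¬ (j : ℕ) + 2 < i by omega, show (j : ℕ) + 2 ≠ i by omega,
      show i < (j : ℕ) + 1 by omega] using this

theorem exists_insertHump_eq {m i : ℕ} (hi : i ≤ m) (p : Fin (m + 2) → Bool)
    (hU : p ⟨i, by omega⟩ = true) (hD : p ⟨i + 1, by omega⟩ = false) :
    ∃ q : Fin m → Bool, insertHump i q = p := by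
  refine ⟨fun j => if (j : ℕ) < i then p ⟨j, by omega⟩ else p ⟨j + 2, by omega⟩, ?_⟩
  ext1 j
  obtain ⟨j, hj⟩ := j
  rcases lt_trichotomy j i with h | rfl | h
  · simp [insertHump, h, show j < m by omega]
  · simp [insertHump, hU]
  · obtain rfl | h' := Nat.eq_or_lt_of_le (Nat.succ_le_of_lt h)
    · simp [insertHump, hD]
    · obtain ⟨l, rfl⟩ := Nat.exists_eq_add_of_le' (show 2 ≤ j by omega)
      simp [insertHump, show ¬ l + 2 < i by omega, show l + 2 ≠ i by omega,
        show i < l + 1 by omega, show ¬ l < i by omega]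

theorem card_dyckPaths_hump_at {m i : ℕ} (hi : i ≤ m) :
    #{p ∈ dyckPaths (m + 2) | p ⟨i, by omega⟩ = true ∧ p ⟨i + 1, by omega⟩ = false} =
      #(dyckPaths m) := by
  refine (Finset.card_bij (fun q _ => insertHump i q) (fun q hq => ?_)
    (fun _ _ _ _ h => insertHump_injective i h) (fun p hp => ?_)).symm
  · rw [mem_dyckPaths] at hq
    simp [mem_dyckPaths, isDyckPath_insertHump q hi, hq, insertHump]
  · rw [Finset.mem_filter, mem_dyckPaths] at hp
    obtain ⟨q, rfl⟩ := exists_insertHump_eq hi p hp.2.1 hp.2.2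
    exact ⟨q, mem_dyckPaths.2 ((isDyckPath_insertHump q hi).1 hp.1), rfl⟩

theorem sum_humps_dyckPaths (m : ℕ) :
    ∑ p ∈ dyckPaths (m + 2), humps p = (m + 1) * #(dyckPaths m) := by
  simp only [humps, Finset.card_filter]
  rw [Finset.sum_comm]
  simp only [← Finset.card_filter]
  refine (Finset.sum_congr rfl fun (i : Fin (m + 2 - 1)) _ =>
    card_dyckPaths_hump_at (Nat.lt_succ_iff.1 i.isLt)).trans ?_
  simp

/-- The sequence of `DyckStep`s of a path. -/
def dyckSteps {m : ℕ} (p : Fin m → Bool) : List DyckStep :=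
  List.ofFn fun i => if p i then DyckStep.U else DyckStep.D

theorem length_dyckSteps {m : ℕ} (p : Fin m → Bool) : (dyckSteps p).length = m := by
  simp [dyckSteps]

theorem dyckSteps_injective {m : ℕ} :
    Function.Injective (dyckSteps : (Fin m → Bool) → List DyckStep) := by
  intro p q h
  ext1 i
  have := congrFun (List.ofFn_injective h) i
  cases hp : p i <;> cases hq : q i <;> simp_all

theorem count_take_dyckSteps {m : ℕ} (p : Fin m → Bool) (k : ℕ) (hk : k ≤ m) :
    (((dyckSteps p).take k).count DyckStep.U : ℤ) - ((dyckSteps p).take k).count DyckStep.D =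
      partialSum p k := by
  induction k with
  | zero => simp [partialSum_zero]
  | succ k ih =>
    rw [partialSum_succ _ _ hk, ← ih (by omega),
      List.take_succ_eq_append_getElem (by rw [length_dyckSteps]; omega)]
    have h : (dyckSteps p)[k]'(by rw [length_dyckSteps]; omega) =
        if p ⟨k, hk⟩ then DyckStep.U else DyckStep.D := by simp [dyckSteps]
    rw [h]
    cases p ⟨k, hk⟩ <;> simp [stepVal] <;> ring

theorem isDyckPath_iff_count {m : ℕ} (p : Fin m → Bool) :
    IsDyckPath p ↔ (dyckSteps p).count DyckStep.U = (dyckSteps p).count DyckStep.D ∧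
      ∀ k, ((dyckSteps p).take k).count DyckStep.D ≤ ((dyckSteps p).take k).count DyckStep.U := by
  have hm := count_take_dyckSteps p m le_rfl
  rw [List.take_of_length_le (length_dyckSteps p).le] at hm
  refine ⟨fun h => ⟨by have := h.1; omega, fun k => ?_⟩, fun h => ⟨by omega, fun k hk => ?_⟩⟩
  · rcases le_total k m with hk | hk
    · have := count_take_dyckSteps p k hk
      have := h.2 k hk
      omega
    · rw [List.take_of_length_le ((length_dyckSteps p).le.trans hk)]
      have := h.1
      omega
  · have := count_take_dyckSteps p k hk
    have := h.2 k
    omega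

theorem exists_dyckSteps_eq {m : ℕ} (l : List DyckStep) (hl : l.length = m) :
    ∃ p : Fin m → Bool, dyckSteps p = l := by
  subst hl
  refine ⟨fun i => decide (l[i] = DyckStep.U), List.ext_getElem (length_dyckSteps _) ?_⟩
  intro i _ hi
  rcases DyckStep.dichotomy l[i] with h | h <;> simp [dyckSteps, h]

theorem card_dyckPaths (n : ℕ) : #(dyckPaths (2 * n)) = catalan n := by
  rw [← DyckWord.card_dyckWord_semilength_eq_catalan, ← Finset.card_univ]
  refine Finset.card_bij (fun p hp =>
    ⟨⟨dyckSteps p, ((isDyckPath_iff_count p).1 (mem_dyckPaths.1 hp)).1,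
      ((isDyckPath_iff_count p).1 (mem_dyckPaths.1 hp)).2⟩, ?_⟩) (fun _ _ => Finset.mem_univ _)
    (fun p _ q _ h => dyckSteps_injective (congrArg (fun w => w.1.toList) h))
    (fun w _ => ?_)
  · have := DyckWord.two_mul_semilength_eq_length (p := ⟨dyckSteps p,
      ((isDyckPath_iff_count p).1 (mem_dyckPaths.1 hp)).1,
      ((isDyckPath_iff_count p).1 (mem_dyckPaths.1 hp)).2⟩)
    rw [length_dyckSteps] at this
    omega
  · obtain ⟨w, hw⟩ := w
    obtain ⟨p, hp⟩ := exists_dyckSteps_eq (m := 2 * n) w.toList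
      (by rw [← DyckWord.two_mul_semilength_eq_length, hw])
    refine ⟨p, mem_dyckPaths.2 ((isDyckPath_iff_count p).2 ?_), ?_⟩
    · rw [hp]
      exact ⟨w.count_U_eq_count_D, w.count_D_le_count_U⟩
    · exact Subtype.ext (DyckWord.ext hp)

theorem two_mul_add_one_mul_catalan (n : ℕ) :
    (2 * n + 1) * catalan n = (2 * n + 1).choose (n + 1) := by
  have h₁ := Nat.add_one_mul_choose_eq (2 * n) n
  have h₂ := succ_mul_catalan_eq_centralBinom n
  rw [Nat.centralBinom] at h₂
  refine Nat.eq_of_mul_eq_mul_right n.succ_pos ?_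
  rw [Nat.succ_eq_add_one, ← h₁, ← h₂]
  ring

/-- For every `n ≥ 1`, the total number of humps over all Dyck paths of length `2n`
equals the binomial coefficient `C(2n-1, n)`. -/
theorem total_humps_dyck (n : ℕ) (hn : 1 ≤ n) :
    HC n = (2 * n - 1).choose n := by
  obtain ⟨m, rfl⟩ := Nat.exists_eq_add_of_le' hn
  rw [HC, show 2 * (m + 1) = 2 * m + 2 by ring, sum_humps_dyckPaths, card_dyckPaths,
    two_mul_add_one_mul_catalan]
  rfl
end

section
/- For every integer n ≥ 2, the total number of humps in Dyck paths satisfies the recurrence HC_n = HC_{n−1} + Σ_{j=1}^{n−1} ( HC_{j−1}·C_{n−j} + C_{j−1}·HC_{n−j} ), where C_m denotes the m-th Catalan number. -/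
open Finset

/-- `HC` with the single-hump convention `HC 0 = 1`. -/
noncomputable def HCc (n : ℕ) : ℕ := if n = 0 then 1 else HC n

open DyckStep BinaryTree

/-- The number of occurrences of `U` immediately followed by `D` in a list of Dyck steps. -/
def peaks : List DyckStep → ℕ
  | [] => 0
  | x :: l => (if x = U ∧ l.head? = some D then 1 else 0) + peaks l

lemma peaks_append (l m : List DyckStep) :
    peaks (l ++ m) =
      peaks l + peaks m + if l.getLast? = some U ∧ m.head? = some D then 1 else 0 := by
  induction l with
  | nil => simp [peaks]
  | cons x l ih =>
    cases l with
    | nil => simp [peaks, add_comm]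
    | cons y l =>
      rw [List.cons_append, peaks, ih, peaks.eq_2 x]
      simp only [List.cons_append, List.head?_cons, List.getLast?_cons_cons]
      grind

lemma peaks_eq_sum (l : List DyckStep) :
    peaks l = ∑ i ∈ range l.length, if l[i]? = some U ∧ l[i + 1]? = some D then 1 else 0 := by
  induction l with
  | nil => simp [peaks]
  | cons x l ih =>
    rw [List.length_cons, sum_range_succ', peaks, ih, add_comm]
    simp [List.head?_eq_getElem?]

lemma DyckWord.head?_ne_some_D (p : DyckWord) : p.toList.head? ≠ some D := by
  intro h
  have hp : p.toList ≠ [] := by rintro h'; simp [h'] at h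
  rw [List.head?_eq_some_head hp, p.head_eq_U] at h
  simp at h

lemma DyckWord.getLast?_ne_some_U (p : DyckWord) : p.toList.getLast? ≠ some U := by
  intro h
  have hp : p.toList ≠ [] := by rintro h'; simp [h'] at h
  rw [List.getLast?_eq_some_getLast hp, p.getLast_eq_D] at h
  simp at h

lemma peaks_nest_add (p q : DyckWord) :
    peaks (p.nest + q).toList = (if p = 0 then 1 else peaks p.toList) + peaks q.toList := by
  have e : (p.nest + q).toList = [U] ++ p.toList ++ [D] ++ q.toList := rfl
  rw [e, peaks_append, peaks_append, peaks_append]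
  have hq := q.head?_ne_some_D
  have hl := p.getLast?_ne_some_U
  have hh := p.head?_ne_some_D
  by_cases hp : p = 0
  · have : (0 : DyckWord).toList = [] := rfl
    simp [peaks, hp, hq, this]
  · obtain ⟨x, hx⟩ := Option.ne_none_iff_exists'.mp
      (mt List.getLast?_eq_none_iff.mp (DyckWord.toList_ne_nil.mpr hp))
    have hxU : x ≠ U := by rintro rfl; exact hl hx
    simp [peaks, hp, hq, hh, List.getLast?_cons, hx, hxU]

/-- The list of Dyck steps of a path. -/
def pathList {m : ℕ} (p : Fin m → Bool) : List DyckStep :=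
  List.ofFn fun i => if p i then U else D

@[simp]
lemma length_pathList {m : ℕ} (p : Fin m → Bool) : (pathList p).length = m := by
  simp [pathList]

lemma pathList_injective {m : ℕ} : Function.Injective (pathList (m := m)) := by
  intro p q h
  funext i
  have := congrFun (List.ofFn_injective h) i
  cases hp : p i <;> cases hq : q i <;> simp_all

lemma exists_pathList_eq (l : List DyckStep) {m : ℕ} (hl : l.length = m) :
    ∃ p : Fin m → Bool, pathList p = l := by
  subst hl
  refine ⟨fun i => l[i] = U, ?_⟩
  apply List.ext_getElem
  · simp
  · intro i h₁ h₂
    rcases l[i].dichotomy with h | h <;> simp [pathList, h]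

lemma humps_eq_peaks {m : ℕ} (p : Fin m → Bool) : humps p = peaks (pathList p) := by
  rw [peaks_eq_sum, length_pathList, humps, card_filter]
  cases m with
  | zero => simp
  | succ k =>
    rw [sum_range_succ, ← Fin.sum_univ_eq_sum_range
      (fun i => if (pathList p)[i]? = some U ∧ (pathList p)[i + 1]? = some D then 1 else 0)]
    have h : (pathList p)[k + 1]? = none := by simp
    simp only [h, reduceCtorEq, and_false, if_false, add_zero]
    refine sum_congr rfl fun i _ => ?_
    have h₁ : (i : ℕ) < k + 1 := by have := i.isLt; omega
    have h₂ : (i : ℕ) + 1 < k + 1 := by have := i.isLt; omega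
    rw [pathList, List.getElem?_ofFn, List.getElem?_ofFn, dif_pos h₁, dif_pos h₂]
    simp

lemma partialSum_eq_count {m : ℕ} (p : Fin m → Bool) (k : ℕ) (hk : k ≤ m) :
    partialSum p k =
      ((pathList p).take k).count U - (((pathList p).take k).count D : ℤ) := by
  induction k with
  | zero => simp [partialSum]
  | succ k ih =>
    have hs : partialSum p (k + 1) = partialSum p k + stepVal (p ⟨k, hk⟩) := by
      have : univ.filter (fun i : Fin m => (i : ℕ) < k + 1) =
          insert ⟨k, hk⟩ (univ.filter fun i : Fin m => (i : ℕ) < k) := by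
        ext i
        simp only [mem_filter, mem_univ, true_and, mem_insert, Fin.ext_iff]
        omega
      rw [partialSum, this, sum_insert (by simp), add_comm, partialSum]
    have hk' : k < (pathList p).length := by simpa using hk
    rw [hs, ih (by omega), List.take_add_one, List.getElem?_eq_getElem hk']
    cases hp : p ⟨k, hk⟩ <;> simp [pathList, hp, stepVal] <;> ring

lemma isDyckPath_iff {m : ℕ} (p : Fin m → Bool) :
    IsDyckPath p ↔ (pathList p).count U = (pathList p).count D ∧
      ∀ i, ((pathList p).take i).count D ≤ ((pathList p).take i).count U := by
  have hm : (pathList p).take m = pathList p := List.take_of_length_le (by simp)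
  have h0 : partialSum p m = 0 ↔ (pathList p).count U = (pathList p).count D := by
    rw [partialSum_eq_count p m le_rfl, hm]
    omega
  rw [IsDyckPath, h0]
  refine and_congr_right fun h => ⟨fun H i => ?_, fun H k hk => ?_⟩
  · rcases le_total i m with hi | hi
    · have := H i hi
      rw [partialSum_eq_count p i hi] at this
      omega
    · rw [List.take_of_length_le (by simpa using hi), h]
  · rw [partialSum_eq_count p k hk]
    have := H k
    omega

/-- The Dyck word of a Dyck path. -/
def IsDyckPath.toDyckWord {m : ℕ} {p : Fin m → Bool} (hp : IsDyckPath p) : DyckWord where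
  toList := pathList p
  count_U_eq_count_D := ((isDyckPath_iff p).mp hp).1
  count_D_le_count_U := ((isDyckPath_iff p).mp hp).2

/-- The number of humps of the Dyck word encoded by a binary tree. -/
def treeHumps (t : BinaryTree Unit) : ℕ := peaks (DyckWord.ofTree t).toList

lemma treeHumps_node (l r : BinaryTree Unit) :
    treeHumps (l △ r) = (if l = nil then 1 else treeHumps l) + treeHumps r := by
  have h : DyckWord.ofTree l = 0 ↔ l = nil := by
    rw [← DyckWord.equivTree.symm.injective.eq_iff (a := l)]
    rfl
  rw [treeHumps, DyckWord.ofTree, peaks_nest_add]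
  simp only [h, treeHumps]

lemma HC_eq_sum_treeHumps (n : ℕ) : HC n = ∑ t ∈ treesOfNumNodesEq n, treeHumps t := by
  have mem {p : Fin (2 * n) → Bool} (hp : p ∈ dyckPaths (2 * n)) : IsDyckPath p := by
    simpa [dyckPaths] using hp
  refine sum_bij (fun p hp => (mem hp).toDyckWord.toTree) ?_ ?_ ?_ ?_
  · intro p hp
    rw [mem_treesOfNumNodesEq, DyckWord.numNodes_toTree]
    have := (mem hp).toDyckWord.two_mul_semilength_eq_length
    rw [IsDyckPath.toDyckWord, length_pathList] at this
    exact Nat.eq_of_mul_eq_mul_left two_pos this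
  · intro p hp q hq h
    exact pathList_injective (congrArg DyckWord.toList (DyckWord.equivTree.injective h))
  · intro t ht
    have hlen : (DyckWord.ofTree t).toList.length = 2 * n := by
      rw [← DyckWord.two_mul_semilength_eq_length, ← DyckWord.numNodes_toTree,
        DyckWord.toTree_ofTree, mem_treesOfNumNodesEq.mp ht]
    obtain ⟨p, hp⟩ := exists_pathList_eq _ hlen
    have hd : IsDyckPath p := by
      rw [isDyckPath_iff, hp]
      exact ⟨(DyckWord.ofTree t).count_U_eq_count_D, (DyckWord.ofTree t).count_D_le_count_U⟩
    refine ⟨p, by simpa [dyckPaths] using hd, ?_⟩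
    have : hd.toDyckWord = DyckWord.ofTree t := DyckWord.ext hp
    rw [this, DyckWord.toTree_ofTree]
  · intro p hp
    rw [treeHumps, DyckWord.ofTree_toTree, humps_eq_peaks]
    rfl

lemma HCc_eq_sum (n : ℕ) :
    HCc n = ∑ t ∈ treesOfNumNodesEq n, if t = nil then 1 else treeHumps t := by
  cases n with
  | zero => simp [HCc]
  | succ n =>
    rw [HCc, if_neg n.succ_ne_zero, HC_eq_sum_treeHumps]
    refine sum_congr rfl fun t ht => ?_
    rw [if_neg]
    rintro rfl
    simp at ht

lemma HC_succ (n : ℕ) :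
    HC (n + 1) = ∑ ij ∈ antidiagonal n,
      (HCc ij.1 * catalan ij.2 + catalan ij.1 * HC ij.2) := by
  rw [HC_eq_sum_treeHumps, treesOfNumNodesEq_succ, sum_biUnion]
  · refine sum_congr rfl fun ij _ => ?_
    rw [sum_map]
    change ∑ x ∈ treesOfNumNodesEq ij.1 ×ˢ treesOfNumNodesEq ij.2, treeHumps (x.1 △ x.2) = _
    rw [sum_product]
    simp only [treeHumps_node, sum_add_distrib, sum_const,
      smul_eq_mul, ← mul_sum, treesOfNumNodesEq_card_eq_catalan, ← HCc_eq_sum,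
      ← HC_eq_sum_treeHumps]
    ring
  · simp_rw [Set.PairwiseDisjoint, Set.Pairwise, Function.onFun, disjoint_left]
    rintro ⟨i, j⟩ _ ⟨i', j'⟩ _ hne t h₁ h₂
    apply hne
    simp only [mem_map, mem_product, mem_treesOfNumNodesEq] at h₁ h₂
    grind

/-- The hump recurrence for Dyck paths, with the convention `HC 0 = 1`. -/
theorem hump_recurrence_dyck (n : ℕ) (hn : 2 ≤ n) :
    HC n = HC (n - 1) +
      ∑ j ∈ Finset.Icc 1 (n - 1),
        (HCc (j - 1) * catalan (n - j) + catalan (j - 1) * HCc (n - j)) := by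
  obtain ⟨n, rfl⟩ := Nat.exists_eq_add_of_le' (by omega : 1 ≤ n)
  have hHC0 : HC 0 = 0 := by simp [HC, humps]
  have hn0 : n ≠ 0 := by omega
  rw [HC_succ, Nat.sum_antidiagonal_eq_sum_range_succ
    (fun i j => HCc i * catalan j + catalan i * HC j), sum_range_succ, add_comm]
  congr 1
  · simp [hHC0, HCc, hn0]
  · rw [Nat.add_sub_cancel, ← Finset.Ico_add_one_right_eq_Icc, sum_Ico_eq_sum_range]
    refine sum_congr (by simp) fun i hi => ?_
    have hi : i < n := by simpa using hi
    have h₁ : 1 + i - 1 = i := by omega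
    have h₂ : n + 1 - (1 + i) = n - i := by omega
    rw [h₁, h₂, HCc.eq_1 (n - i), if_neg (by omega)]
end

section
/- Let a : ℕ → ℕ satisfy a(0) = a(1) = 1 and, for all n ≥ 2, a(n) = a(n−1) + Σ_{j=1}^{n−1} ( a(j−1)·C_{n−j} + C_{j−1}·a(n−j) ), where C_m is the m-th Catalan number. Then a(n) = C(2n−1, n) for all n ≥ 1. -/
open Finset in
/-- The convolution of central binomial coefficients with Catalan numbers. -/
theorem two_mul_sum_centralBinom_mul_catalan (m : ℕ) :
    2 * ∑ i ∈ range (m + 1), i.centralBinom * catalan (m - i) = (m + 1).centralBinom := by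
  have hflip := sum_range_reflect (fun i => i.centralBinom * catalan (m - i)) (m + 1)
  rw [two_mul]
  nth_rewrite 1 [← hflip]
  rw [← sum_add_distrib, ← succ_mul_catalan_eq_centralBinom (m + 1), catalan_succ,
    Fin.sum_univ_eq_sum_range (fun i => catalan i * catalan (m - i)) m.succ, mul_sum]
  refine sum_congr rfl fun i hi => ?_
  obtain ⟨k, rfl⟩ := Nat.exists_eq_add_of_le (Nat.lt_succ_iff.mp (mem_range.mp hi))
  have h₁ : i + k + 1 - 1 - i = k := by omega
  have h₂ : i + k - k = i := by omega
  have h₃ : i + k - i = k := by omega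
  rw [h₁, h₂, h₃, ← succ_mul_catalan_eq_centralBinom, ← succ_mul_catalan_eq_centralBinom]
  ring

open Finset in
/-- The hump recurrence, written as a full convolution with the Catalan numbers. -/
theorem hump_recurrence_convolution (a : ℕ → ℕ) (h0 : a 0 = 1) (h1 : a 1 = 1)
    (hrec : ∀ n, 2 ≤ n →
      a n = a (n - 1) +
        ∑ j ∈ Icc 1 (n - 1), (a (j - 1) * catalan (n - j) + catalan (j - 1) * a (n - j)))
    (m : ℕ) :
    a (m + 1) + catalan m = 2 * ∑ i ∈ range (m + 1), a i * catalan (m - i) := by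
  rcases Nat.eq_zero_or_pos m with rfl | hm
  · simp [h0, h1]
  have hshift : ∑ j ∈ Icc 1 m,
      (a (j - 1) * catalan (m + 1 - j) + catalan (j - 1) * a (m + 1 - j)) =
      ∑ i ∈ range m, (a i * catalan (m - i) + catalan i * a (m - i)) := by
    rw [← Ico_add_one_right_eq_Icc, sum_Ico_eq_sum_range]
    refine sum_congr rfl fun i _ => ?_
    rw [Nat.add_sub_cancel_left, show m + 1 - (1 + i) = m - i by omega]
  have hflip : ∑ i ∈ range (m + 1), catalan i * a (m - i) =
      ∑ i ∈ range (m + 1), a i * catalan (m - i) := by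
    rw [← sum_range_reflect]
    refine sum_congr rfl fun i hi => ?_
    have := mem_range.mp hi
    rw [Nat.add_sub_cancel, Nat.sub_sub_self (by omega), mul_comm]
  have hstep := hrec (m + 1) (by omega)
  rw [Nat.add_sub_cancel, hshift, sum_add_distrib] at hstep
  rw [two_mul]
  nth_rewrite 2 [← hflip]
  rw [sum_range_succ, sum_range_succ, Nat.sub_self, catalan_zero, h0, hstep]
  ring

open Finset in
/-- Doubling a solution of the hump recurrence gives the central binomial coefficients,
up to a correction at `0`. -/
theorem two_mul_hump_recurrence (a : ℕ → ℕ) (h0 : a 0 = 1)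
    (hconv : ∀ m, a (m + 1) + catalan m = 2 * ∑ i ∈ range (m + 1), a i * catalan (m - i))
    (n : ℕ) : 2 * a n = n.centralBinom + if n = 0 then 1 else 0 := by
  induction n using Nat.strong_induction_on with
  | _ n ih =>
    rcases n with _ | m
    · simp [h0]
    have hsum : 2 * ∑ i ∈ range (m + 1), a i * catalan (m - i) =
        ∑ i ∈ range (m + 1), i.centralBinom * catalan (m - i) + catalan m := by
      rw [mul_sum, sum_congr rfl fun i hi => by rw [← mul_assoc, ih i (mem_range.mp hi), add_mul],
        sum_add_distrib]
      simp
    have hstep := hconv m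
    have hbinom := two_mul_sum_centralBinom_mul_catalan m
    rw [if_neg m.succ_ne_zero]
    omega

/-- Any sequence satisfying the hump recurrence with `a 0 = a 1 = 1`
equals `C(2n-1, n)` for all `n ≥ 1`. -/
theorem hump_recurrence_solution (a : ℕ → ℕ) (h0 : a 0 = 1) (h1 : a 1 = 1)
    (hrec : ∀ n, 2 ≤ n →
      a n = a (n - 1) +
        ∑ j ∈ Finset.Icc 1 (n - 1),
          (a (j - 1) * catalan (n - j) + catalan (j - 1) * a (n - j))) :
    ∀ n, 1 ≤ n → a n = (2 * n - 1).choose n := by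
  intro n hn
  obtain ⟨m, rfl⟩ := Nat.exists_eq_add_of_le' hn
  have hdouble := two_mul_hump_recurrence a h0 (hump_recurrence_convolution a h0 h1 hrec) (m + 1)
  rw [if_neg m.succ_ne_zero, Nat.centralBinom_eq_two_mul_choose,
    show 2 * (m + 1) = 2 * m + 1 + 1 by ring, Nat.choose_succ_succ',
    ← Nat.choose_symm_half m] at hdouble
  rw [show 2 * (m + 1) - 1 = 2 * m + 1 by omega]
  omega
end

section
/- For every integer n ≥ 2, the following binomial identity holds (as an identity of rational numbers): 2·Σ_{j=1}^{⌊n/2⌋} C(n, j)·C(n−j, j) = Σ_{r=0}^{n−1} C(n−r, ⌊(n−r)/2⌋)·C(n, r) + Σ_{k=1}^{⌊n/2⌋−1} n! / ( k!·(k+1)!·(n−2k−2)!·(n−k−1)·(n−k) ). -/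
open Finset in
theorem Finset.sum_range_two_mul {M : Type*} [AddCommMonoid M] (f : ℕ → M) (n : ℕ) :
    ∑ m ∈ range (2 * n), f m = ∑ k ∈ range n, (f (2 * k) + f (2 * k + 1)) := by
  induction n with
  | zero => simp
  | succ n ih => rw [Nat.mul_succ, sum_range_succ, sum_range_succ, ih, sum_range_succ, add_assoc]

/-- The product of binomials counting words with `k` up steps, `k` down steps and `d` flat steps. -/
theorem Nat.cast_choose_mul_choose_sub (k d : ℕ) :
    ((2 * k + d).choose k : ℚ) * ((2 * k + d - k).choose k : ℚ) =
      (2 * k + d).factorial / (k.factorial * k.factorial * d.factorial) := by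
  rw [Nat.cast_choose ℚ (by omega : k ≤ 2 * k + d),
    Nat.cast_choose ℚ (by omega : k ≤ 2 * k + d - k),
    show 2 * k + d - k - k = d by omega]
  field_simp

theorem Nat.cast_choose_mul_choose_two_mul (k d : ℕ) :
    ((2 * k).choose k : ℚ) * ((2 * k + d).choose (2 * k) : ℚ) =
      (2 * k + d).factorial / (k.factorial * k.factorial * d.factorial) := by
  rw [Nat.cast_choose ℚ (by omega : k ≤ 2 * k), Nat.cast_choose ℚ (by omega : 2 * k ≤ 2 * k + d),
    show 2 * k - k = k by omega, show 2 * k + d - 2 * k = d by omega]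
  field_simp

theorem Nat.cast_choose_mul_choose_two_mul_add_one (k d : ℕ) :
    ((2 * k + 1).choose k : ℚ) * ((2 * k + 1 + d).choose (2 * k + 1) : ℚ) =
      (2 * k + 1 + d).factorial / (k.factorial * (k + 1).factorial * d.factorial) := by
  rw [Nat.cast_choose ℚ (by omega : k ≤ 2 * k + 1),
    Nat.cast_choose ℚ (by omega : 2 * k + 1 ≤ 2 * k + 1 + d),
    show 2 * k + 1 - k = k + 1 by omega, show 2 * k + 1 + d - (2 * k + 1) = d by omega]
  field_simp

/-- The summand of the Riordan numbers (Motzkin sums). -/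
def riordanTerm (n k : ℕ) : ℚ :=
  (n.factorial : ℚ) /
    ((k.factorial : ℚ) * ((k + 1).factorial : ℚ) * ((n - 2 * k - 2).factorial : ℚ) *
      ((n - k - 1 : ℕ) : ℚ) * ((n - k : ℕ) : ℚ))

/-- Telescoping evaluation of the partial sums of the difference between the central trinomial
coefficient, its neighbour, and the Riordan number. -/
theorem sum_range_trinomial_sub_riordanTerm (n m : ℕ) (h : 2 * m ≤ n) :
    ∑ k ∈ Finset.range m, (((n.choose k : ℚ) * ((n - k).choose k : ℚ)) -
      ((2 * k + 1).choose k : ℚ) * (n.choose (2 * k + 1) : ℚ) - riordanTerm n k) =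
      -(m * n.factorial / (m.factorial * m.factorial * (n - 2 * m).factorial * (n - m : ℕ))) := by
  induction m with
  | zero => simp
  | succ m ih =>
    obtain ⟨d, rfl⟩ := Nat.exists_eq_add_of_le h
    rw [Finset.sum_range_succ, ih (by omega), riordanTerm]
    have hT := Nat.cast_choose_mul_choose_sub m (d + 2)
    have hU := Nat.cast_choose_mul_choose_two_mul_add_one m (d + 1)
    rw [show 2 * m + (d + 2) = 2 * (m + 1) + d by ring] at hT
    rw [show 2 * m + 1 + (d + 1) = 2 * (m + 1) + d by ring] at hU
    rw [hT, hU, show 2 * (m + 1) + d - 2 * m = d + 2 by omega,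
      show d + 2 - 2 = d by omega,
      show 2 * (m + 1) + d - m = m + d + 2 by omega,
      show m + d + 2 - 1 = m + d + 1 by omega,
      show 2 * (m + 1) + d - 2 * (m + 1) = d by omega,
      show 2 * (m + 1) + d - (m + 1) = m + d + 1 by omega]
    simp only [Nat.factorial_succ m, Nat.factorial_succ d, Nat.factorial_succ (d + 1)]
    push_cast
    have h₁ : (m : ℚ) + d + 1 ≠ 0 := by positivity
    have h₂ : (m : ℚ) + d + 2 ≠ 0 := by positivity
    field_simp
    ring

theorem sum_range_trinomial_sub_eq_sum_riordanTerm (n : ℕ) (hn : 2 ≤ n) :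
    ∑ k ∈ Finset.range (n / 2 + 1), (((n.choose k : ℚ) * ((n - k).choose k : ℚ)) -
      ((2 * k + 1).choose k : ℚ) * (n.choose (2 * k + 1) : ℚ)) =
      ∑ k ∈ Finset.range (n / 2), riordanTerm n k := by
  have h := sum_range_trinomial_sub_riordanTerm n (n / 2) (by omega)
  rw [Finset.sum_sub_distrib, sub_eq_iff_eq_add] at h
  rw [Finset.sum_range_succ, h]
  obtain ⟨m, rfl | rfl⟩ := Nat.even_or_odd' n
  · have hm : (m : ℚ) ≠ 0 := by norm_cast; omega
    have hT := Nat.cast_choose_mul_choose_sub m 0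
    rw [add_zero] at hT
    rw [show 2 * m / 2 = m by omega, hT, Nat.choose_eq_zero_of_lt (by omega : 2 * m < 2 * m + 1),
      show 2 * m - 2 * m = 0 by omega, show 2 * m - m = m by omega]
    simp only [Nat.factorial_zero, Nat.cast_one, Nat.cast_zero]
    field_simp
    ring
  · have hT := Nat.cast_choose_mul_choose_sub m 1
    have hU := Nat.cast_choose_mul_choose_two_mul_add_one m 0
    rw [add_zero] at hU
    rw [show (2 * m + 1) / 2 = m by omega, hT, hU, show 2 * m + 1 - 2 * m = 1 by omega,
      show 2 * m + 1 - m = m + 1 by omega, Nat.factorial_succ m]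
    simp only [Nat.factorial_zero, Nat.factorial_one, Nat.cast_one]
    push_cast
    field_simp
    ring

theorem sum_range_choose_half_mul_choose (n : ℕ) :
    ∑ r ∈ Finset.range n, (((n - r).choose ((n - r) / 2) : ℚ) * (n.choose r : ℚ)) + 1 =
      ∑ k ∈ Finset.range (n / 2 + 1), ((n.choose k : ℚ) * ((n - k).choose k : ℚ) +
        ((2 * k + 1).choose k : ℚ) * (n.choose (2 * k + 1) : ℚ)) := by
  have hreflect :
      ∑ r ∈ Finset.range n, (((n - r).choose ((n - r) / 2) : ℚ) * (n.choose r : ℚ)) + 1 =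
      ∑ m ∈ Finset.range (n + 1), ((m.choose (m / 2) : ℚ) * (n.choose m : ℚ)) := by
    rw [← Finset.sum_range_reflect _ (n + 1), Finset.sum_range_succ]
    congr 1
    · refine Finset.sum_congr rfl fun r hr => ?_
      have hr : r < n := Finset.mem_range.1 hr
      rw [show n + 1 - 1 - r = n - r by omega, Nat.choose_symm hr.le]
    · simp
  rw [hreflect, Finset.sum_subset
    (Finset.range_subset_range.2 (by omega : n + 1 ≤ 2 * (n / 2 + 1))) fun m _ hm => ?_,
    Finset.sum_range_two_mul]
  · refine Finset.sum_congr rfl fun k hk => ?_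
    have hk := Finset.mem_range.1 hk
    obtain ⟨d, rfl⟩ := Nat.exists_eq_add_of_le (by omega : 2 * k ≤ n)
    rw [show 2 * k / 2 = k by omega, show (2 * k + 1) / 2 = k by omega,
      Nat.cast_choose_mul_choose_two_mul, Nat.cast_choose_mul_choose_sub]
  · rw [Nat.choose_eq_zero_of_lt (by simpa using hm : n < m), Nat.cast_zero, mul_zero]

theorem Finset.sum_range_succ_eq_add_sum_Icc {M : Type*} [AddCommMonoid M] (f : ℕ → M) (n : ℕ) :
    ∑ k ∈ range (n + 1), f k = f 0 + ∑ k ∈ Icc 1 n, f k := by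
  rw [range_eq_Ico, sum_eq_sum_Ico_succ_bot (by omega)]
  rfl


/-- The binomial identity of Lemma 3.5, as an identity of rational numbers. -/
theorem binomial_identity_motzkin (n : ℕ) (hn : 2 ≤ n) :
    2 * ∑ j ∈ Finset.Icc 1 (n / 2), ((n.choose j : ℚ) * ((n - j).choose j : ℚ)) =
      ∑ r ∈ Finset.range n, (((n - r).choose ((n - r) / 2) : ℚ) * (n.choose r : ℚ)) +
        ∑ k ∈ Finset.Icc 1 (n / 2 - 1),
          (n.factorial : ℚ) /
            ((k.factorial : ℚ) * ((k + 1).factorial : ℚ) * ((n - 2 * k - 2).factorial : ℚ) *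
              ((n - k - 1 : ℕ) : ℚ) * ((n - k : ℕ) : ℚ)) := by
  have hR := sum_range_trinomial_sub_eq_sum_riordanTerm n hn
  have hA := sum_range_choose_half_mul_choose n
  rw [Finset.sum_sub_distrib] at hR
  rw [Finset.sum_add_distrib] at hA
  have hT := Finset.sum_range_succ_eq_add_sum_Icc
    (fun k => (n.choose k : ℚ) * ((n - k).choose k : ℚ)) (n / 2)
  have hB := Finset.sum_range_succ_eq_add_sum_Icc (riordanTerm n) (n / 2 - 1)
  rw [Nat.sub_add_cancel (by omega : 1 ≤ n / 2)] at hB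
  have hB₀ : riordanTerm n 0 = 1 := by
    obtain ⟨d, rfl⟩ := Nat.exists_eq_add_of_le' hn
    simp only [riordanTerm, Nat.factorial_succ, Nat.mul_zero, Nat.sub_zero, Nat.add_sub_cancel,
      show d + 2 - 1 = d + 1 by omega]
    push_cast
    field_simp
    simp [add_assoc, one_add_one_eq_two]
  simp only [Nat.choose_zero_right, Nat.cast_one, mul_one] at hT
  rw [hB₀] at hB
  simp only [riordanTerm] at hB hR
  linarith
end

section
/- For every integer n ≥ 1, twice the total number of humps over all double-Dyck paths of length 2(n+1) equals (n+3) times the number of such paths: 2·HS(4,0;n) = (n+3)·C_{⌊(n+1)/2⌋}·C_{⌈(n+1)/2⌉}; equivalently HS(4,0;n) = ((n+3)/2)·S(4,0;n) where S(4,0;n) = C_{⌊(n+1)/2⌋}·C_{⌈(n+1)/2⌉}. -/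
open Finset

open Classical in
/-- Double-Dyck paths: Dyck paths of length `2(n+1)` passing through `(2⌊(n+1)/2⌋, 0)`. -/
noncomputable def doubleDyckPaths (n : ℕ) : Finset (Fin (2 * (n + 1)) → Bool) :=
  (dyckPaths (2 * (n + 1))).filter (fun p => partialSum p (2 * ((n + 1) / 2)) = 0)

open DyckStep

/-- The number of occurrences of an up-step immediately followed by a down-step. -/
def peakCount : List DyckStep → ℕ
  | [] => 0
  | a :: l => (if a = U ∧ l.head? = some D then 1 else 0) + peakCount l

lemma peakCount_append (l m : List DyckStep) :
    peakCount (l ++ m) = peakCount l + peakCount m +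
      if l.getLast? = some U ∧ m.head? = some D then 1 else 0 := by
  induction l with
  | nil => simp [peakCount]
  | cons a l ih =>
    cases l with
    | nil => simp [peakCount]; ring
    | cons b l =>
      rw [List.cons_append, peakCount, ih, peakCount.eq_2 a (b :: l)]
      simp only [List.cons_append, List.head?_cons, List.getLast?_cons_cons]
      grind

namespace DyckWord

lemma head?_ne_D (p : DyckWord) : p.toList.head? ≠ some D := by
  by_cases h : p.toList = []
  · simp [h]
  · rw [List.head?_eq_some_head h, p.head_eq_U h]
    simp

lemma getLast?_ne_U (p : DyckWord) : p.toList.getLast? ≠ some U := by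
  by_cases h : p.toList = []
  · simp [h]
  · rw [List.getLast?_eq_some_getLast h, p.getLast_eq_D h]
    simp

lemma peakCount_add (p q : DyckWord) :
    peakCount (p + q).toList = peakCount p.toList + peakCount q.toList := by
  have h : (p + q).toList = p.toList ++ q.toList := rfl
  rw [h, peakCount_append]
  simp [p.getLast?_ne_U]

lemma peakCount_nest (p : DyckWord) :
    peakCount p.nest.toList = if p = 0 then 1 else peakCount p.toList := by
  have h : p.nest.toList = [U] ++ (p.toList ++ [D]) := by simp [nest]
  rw [h, peakCount_append, peakCount_append]
  by_cases hp : p = 0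
  · subst hp
    have h0 : (0 : DyckWord).toList = [] := rfl
    simp [h0, peakCount]
  · have h1 := toList_ne_nil.2 hp
    have h2 : (p.toList ++ [D]).head? ≠ some D := by
      rw [List.head?_append_of_ne_nil _ h1]
      exact p.head?_ne_D
    simp only [peakCount, List.head?_nil, h2, List.getLast?_singleton, p.getLast?_ne_U, hp]
    simp

lemma semilength_ofTree (t : BinaryTree Unit) : (ofTree t).semilength = t.numNodes := by
  rw [← numNodes_toTree, toTree_ofTree]

lemma ofTree_eq_zero_iff (t : BinaryTree Unit) : ofTree t = 0 ↔ t = .nil := by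
  cases t with
  | nil => simp [ofTree]
  | node _ l r =>
    simp only [reduceCtorEq, iff_false]
    intro h
    have := congrArg semilength h
    simp [ofTree] at this

end DyckWord

namespace BinaryTree

/-- The mirror image of a binary tree. -/
def mirror {α : Type*} : BinaryTree α → BinaryTree α
  | nil => nil
  | node a l r => node a r.mirror l.mirror

@[simp] lemma mirror_mirror {α : Type*} (t : BinaryTree α) : t.mirror.mirror = t := by
  induction t <;> simp_all [mirror]

@[simp] lemma numNodes_mirror {α : Type*} (t : BinaryTree α) :
    t.mirror.numNodes = t.numNodes := by
  induction t with
  | nil => rfl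
  | node _ l r hl hr => simp [mirror, hl, hr, add_comm]

lemma mirror_eq_nil {α : Type*} (t : BinaryTree α) : t.mirror = nil ↔ t = nil := by
  cases t <;> simp [mirror]

/-- The number of peaks of the Dyck word encoded by a binary tree. -/
def peaks (t : BinaryTree Unit) : ℕ := peakCount (DyckWord.ofTree t).toList

lemma peaks_nil : peaks nil = 0 := rfl

lemma peaks_node (a : Unit) (l r : BinaryTree Unit) :
    peaks (node a l r) = (if l = nil then 1 else peaks l) + peaks r := by
  rw [peaks, DyckWord.ofTree, DyckWord.peakCount_add, DyckWord.peakCount_nest]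
  simp only [DyckWord.ofTree_eq_zero_iff, peaks]

lemma peaks_add_peaks_mirror (t : BinaryTree Unit) (ht : t ≠ nil) :
    peaks t + peaks t.mirror = t.numNodes + 1 := by
  induction t with
  | nil => exact absurd rfl ht
  | node a l r hl hr =>
    rw [mirror, peaks_node, peaks_node, numNodes]
    simp only [mirror_eq_nil]
    by_cases h1 : l = nil <;> by_cases h2 : r = nil
    · simp [h1, h2, mirror, peaks_nil]
    · have := hr h2
      simp [h1, h2, mirror, peaks_nil]
      omega
    · have := hl h1
      simp [h1, h2, peaks_nil]
      omega
    · have := hl h1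
      have := hr h2
      simp only [h1, h2, if_false]
      omega

lemma two_mul_sum_peaks (n : ℕ) (hn : 1 ≤ n) :
    2 * ∑ t ∈ treesOfNumNodesEq n, peaks t = (n + 1) * catalan n := by
  have h : ∑ t ∈ treesOfNumNodesEq n, peaks t = ∑ t ∈ treesOfNumNodesEq n, peaks t.mirror :=
    Finset.sum_nbij' mirror mirror (by simp) (by simp) (by simp) (by simp) (by simp)
  rw [two_mul]
  nth_rewrite 2 [h]
  rw [← Finset.sum_add_distrib, ← treesOfNumNodesEq_card_eq_catalan, mul_comm,
    ← smul_eq_mul, ← Finset.sum_const]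
  refine Finset.sum_congr rfl fun t ht ↦ ?_
  rw [mem_treesOfNumNodesEq] at ht
  rw [peaks_add_peaks_mirror t, ht]
  rintro rfl
  simp at ht
  omega

end BinaryTree

/-- The Dyck step encoded by a Boolean. -/
def DyckStep.ofBool (b : Bool) : DyckStep := if b then U else D

lemma DyckStep.ofBool_injective : Function.Injective DyckStep.ofBool := by
  intro a b
  cases a <;> cases b <;> simp [DyckStep.ofBool]

/-- The list of steps of a path. -/
def pathWord {m : ℕ} (p : Fin m → Bool) : List DyckStep := List.ofFn fun i ↦ DyckStep.ofBool (p i)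

@[simp] lemma length_pathWord {m : ℕ} (p : Fin m → Bool) : (pathWord p).length = m := by
  simp [pathWord]

lemma pathWord_succ {m : ℕ} (p : Fin (m + 1) → Bool) :
    pathWord p = DyckStep.ofBool (p 0) :: pathWord (fun i ↦ p i.succ) := by
  simp [pathWord, List.ofFn_succ]

lemma pathWord_injective {m : ℕ} : Function.Injective (pathWord (m := m)) := by
  intro p q h
  funext i
  exact DyckStep.ofBool_injective (congrFun (List.ofFn_injective h) i)

/-- The path of length `m` with the steps of a given list. -/
def pathOfWord (m : ℕ) (l : List DyckStep) : Fin m → Bool := fun i ↦ decide (l.getD i U = U)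

lemma pathWord_pathOfWord {m : ℕ} {l : List DyckStep} (h : l.length = m) :
    pathWord (pathOfWord m l) = l := by
  refine List.ext_getElem (by simp [h]) fun i h1 h2 ↦ ?_
  rcases (l[i]).dichotomy with h3 | h3 <;>
    simp [pathWord, pathOfWord, DyckStep.ofBool, h2, h3]

lemma humps_eq_peakCount {m : ℕ} (p : Fin m → Bool) : humps p = peakCount (pathWord p) := by
  induction m with
  | zero => simp [humps, pathWord, peakCount]
  | succ m ih =>
    rw [pathWord_succ, peakCount, ← ih]
    cases m with
    | zero => simp [humps, pathWord]
    | succ m =>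
      rw [pathWord_succ]
      simp only [humps]
      erw [Fin.card_filter_univ_succ]
      cases h0 : p 0 <;> cases h1 : p 1 <;>
        simp [h0, h1, DyckStep.ofBool, add_comm 1]

lemma partialSum_eq {m : ℕ} (p : Fin m → Bool) (k : ℕ) :
    partialSum p k =
      (((pathWord p).take k).count U : ℤ) - (((pathWord p).take k).count D : ℤ) := by
  induction m generalizing k with
  | zero => simp [partialSum, pathWord]
  | succ m ih =>
    cases k with
    | zero => simp [partialSum]
    | succ k =>
      have h : partialSum p (k + 1) = stepVal (p 0) + partialSum (fun i ↦ p i.succ) k := by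
        simp [partialSum, Finset.sum_filter, Fin.sum_univ_succ]
      rw [h, ih, pathWord_succ, List.take_succ_cons]
      cases p 0 <;> simp [stepVal, DyckStep.ofBool] <;> ring

lemma isDyckPath_iff_s15 {m : ℕ} (p : Fin m → Bool) :
    IsDyckPath p ↔ ∃ w : DyckWord, w.toList = pathWord p := by
  have hm : (pathWord p).take m = pathWord p := List.take_of_length_le (by simp)
  constructor
  · rintro ⟨h1, h2⟩
    rw [partialSum_eq, hm] at h1
    refine ⟨⟨pathWord p, by omega, fun i ↦ ?_⟩, rfl⟩
    rcases le_total i m with hi | hi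
    · have := h2 i hi
      rw [partialSum_eq] at this
      omega
    · rw [List.take_of_length_le (by simpa using hi)]
      omega
  · rintro ⟨w, hw⟩
    refine ⟨?_, fun k _ ↦ ?_⟩
    · rw [partialSum_eq, hm, ← hw, w.count_U_eq_count_D, sub_self]
    · have := w.count_D_le_count_U k
      rw [partialSum_eq, ← hw]
      omega

open DyckWord BinaryTree in
lemma sum_humps_doubleDyckPaths (n a b : ℕ) (ha : a = (n + 1) / 2) (hb : b = (n + 2) / 2) :
    ∑ p ∈ doubleDyckPaths n, humps p =
      ∑ x ∈ treesOfNumNodesEq a ×ˢ treesOfNumNodesEq b, (peaks x.1 + peaks x.2) := by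
  have hab : a + b = n + 1 := by omega
  have hlen (t : BinaryTree Unit) : (ofTree t).toList.length = 2 * t.numNodes := by
    rw [← two_mul_semilength_eq_length, semilength_ofTree]
  have hword {x : BinaryTree Unit × BinaryTree Unit}
      (hx : x ∈ treesOfNumNodesEq a ×ˢ treesOfNumNodesEq b) :
      pathWord (pathOfWord (2 * (n + 1)) (ofTree x.1 + ofTree x.2).toList) =
        (ofTree x.1).toList ++ (ofTree x.2).toList := by
    simp only [Finset.mem_product, mem_treesOfNumNodesEq] at hx
    refine pathWord_pathOfWord (l := (ofTree x.1).toList ++ (ofTree x.2).toList) ?_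
    rw [List.length_append, hlen, hlen]
    omega
  symm
  refine Finset.sum_bij
    (fun x _ ↦ pathOfWord (2 * (n + 1)) (ofTree x.1 + ofTree x.2).toList) ?_ ?_ ?_ ?_
  · intro x hx
    have h := hword hx
    simp only [Finset.mem_product, mem_treesOfNumNodesEq] at hx
    simp only [doubleDyckPaths, dyckPaths, Finset.mem_filter, Finset.mem_univ, true_and]
    refine ⟨(isDyckPath_iff_s15 _).2 ⟨ofTree x.1 + ofTree x.2, h.symm⟩, ?_⟩
    rw [partialSum_eq, h, List.take_left' (by rw [hlen]; omega),
      (ofTree x.1).count_U_eq_count_D, sub_self]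
  · intro x hx y hy hxy
    have h := (hword hx).symm.trans ((congrArg pathWord hxy).trans (hword hy))
    simp only [Finset.mem_product, mem_treesOfNumNodesEq] at hx hy
    obtain ⟨h1, h2⟩ := List.append_inj h (by rw [hlen, hlen]; omega)
    exact Prod.ext (equivTree.symm.injective (DyckWord.ext h1))
      (equivTree.symm.injective (DyckWord.ext h2))
  · intro p hp
    simp only [doubleDyckPaths, dyckPaths, Finset.mem_filter, Finset.mem_univ, true_and] at hp
    obtain ⟨hd, h0⟩ := hp
    obtain ⟨w, hw⟩ := (isDyckPath_iff_s15 p).1 hd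
    rw [partialSum_eq, ← hw, ← ha, sub_eq_zero, Nat.cast_inj] at h0
    have hl : w.toList.length = 2 * (n + 1) := by rw [hw, length_pathWord]
    have hx : ((w.take _ h0).toTree, (w.drop _ h0).toTree) ∈
        treesOfNumNodesEq a ×ˢ treesOfNumNodesEq b := by
      have h1 := (w.take _ h0).two_mul_semilength_eq_length
      have h2 := (w.drop _ h0).two_mul_semilength_eq_length
      simp only [DyckWord.take, DyckWord.drop, List.length_take, List.length_drop, hl] at h1 h2
      simp only [Finset.mem_product, mem_treesOfNumNodesEq, numNodes_toTree]
      simp only [DyckWord.take, DyckWord.drop]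
      omega
    refine ⟨_, hx, pathWord_injective ?_⟩
    rw [hword hx, ofTree_toTree, ofTree_toTree, ← hw]
    exact List.take_append_drop _ _
  · intro x hx
    rw [humps_eq_peakCount, hword hx]
    exact (peakCount_add _ _).symm

/-- Twice the total number of humps over all double-Dyck paths of length `2(n+1)`
equals `(n+3)` times the number of such paths:
`2 · HS(4,0;n) = (n+3) · C_{⌊(n+1)/2⌋} · C_{⌈(n+1)/2⌉}`. -/
theorem double_dyck_humps_eq (n : ℕ) (hn : 1 ≤ n) :
    2 * ∑ p ∈ doubleDyckPaths n, humps p =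
      (n + 3) * (catalan ((n + 1) / 2) * catalan ((n + 2) / 2)) := by
  have h1 := BinaryTree.two_mul_sum_peaks ((n + 1) / 2) (by omega)
  have h2 := BinaryTree.two_mul_sum_peaks ((n + 2) / 2) (by omega)
  have hab : n + 3 = ((n + 1) / 2 + 1) + ((n + 2) / 2 + 1) := by omega
  rw [sum_humps_doubleDyckPaths n _ _ rfl rfl, Finset.sum_product, hab]
  simp only [Finset.sum_add_distrib, Finset.sum_const, smul_eq_mul,
    BinaryTree.treesOfNumNodesEq_card_eq_catalan, ← Finset.mul_sum]
  linear_combination catalan ((n + 2) / 2) * h1 + catalan ((n + 1) / 2) * h2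
end
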